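/- arXiv:2603.10896 — 3 statements merged into one kernel-verified Lean document; each statement's English description precedes it below -/
import Mathlib

section
/- Fix x ∈ V and ε > 0, and let D = {y ∈ V : P_y[τ_{{x}} < ∞] > ε}. Then D is transient for the chain: for every z ∈ V, P_z[X_n ∈ D for infinitely many n] = 0. -/
open MeasureTheory Filter

section Setup

variable {V : Type*} [MeasurableSpace V]

/-- Total weight at a vertex: `a_x = Σ_{z∼x} a_{x,z}`. -/
noncomputable def aTot (G : SimpleGraph V) [G.LocallyFinite] (a : V → V → ℝ) (x : V) : ℝ :=
  ∑ z ∈ G.neighborFinset x, a x z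

open Classical in
/-- Transition probabilities of the weighted random walk:
`p(x,y) = a_{x,y}/a_x` for edges and `0` otherwise. -/
noncomputable def step (G : SimpleGraph V) [G.LocallyFinite] (a : V → V → ℝ) (x y : V) : ℝ :=
  if G.Adj x y then a x y / aTot G a x else 0

/-- The event `{τ_K^+ = ∞}`: the walk never returns to `K` at a time `n ≥ 1`. -/
def noReturn (K : Set V) : Set (ℕ → V) := {w | ∀ n ≥ 1, w n ∉ K}

/-- The event `{τ_K < ∞}`: the walk hits `K`. -/
def hits (K : Set V) : Set (ℕ → V) := {w | ∃ n, w n ∈ K}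

/-- The event `{τ_K < ∞ and X_{τ_K} = y}`: the walk hits `K`, entering it at `y`. -/
def hitsAt (K : Set V) (y : V) : Set (ℕ → V) :=
  {w | (∃ n, w n ∈ K) ∧ w (sInf {n | w n ∈ K}) = y}

/-- The event `{λ_K < ∞ and X_{λ_K} = y}`: the walk visits `K`, finitely often,
and its last visit to `K` is at `y`. -/
def lastVisitAt (K : Set V) (y : V) : Set (ℕ → V) :=
  {w | (∃ n, w n ∈ K) ∧ {n | w n ∈ K}.Finite ∧ w (sSup {n | w n ∈ K}) = y}

open Classical in
/-- The equilibrium measure of a finite vertex set `K`: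
`e_K(x) = a_x · P_x[τ_K^+ = ∞]` for `x ∈ K`, and `0` otherwise. -/
noncomputable def equil (G : SimpleGraph V) [G.LocallyFinite] (a : V → V → ℝ)
    (P : V → Measure (ℕ → V)) (K : Finset V) (x : V) : ℝ :=
  if x ∈ K then aTot G a x * ((P x) (noReturn (K : Set V))).toReal else 0

/-- The capacity of a finite vertex set `K`: `cap(K) = Σ_{x∈K} e_K(x)`. -/
noncomputable def capa (G : SimpleGraph V) [G.LocallyFinite] (a : V → V → ℝ)
    (P : V → Measure (ℕ → V)) (K : Finset V) : ℝ :=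
  ∑ x ∈ K, equil G a P K x

/-- The harmonic measure of a nonempty finite vertex set `K`: `harm_K = e_K / cap(K)`. -/
noncomputable def harm (G : SimpleGraph V) [G.LocallyFinite] (a : V → V → ℝ)
    (P : V → Measure (ℕ → V)) (K : Finset V) (x : V) : ℝ :=
  equil G a P K x / capa G a P K

end Setup

section PathSpace

variable {V : Type*}

/-- The paths that agree with `c` up to time `n`. -/
def pathCylinder (n : ℕ) (c : ℕ → V) : Set (ℕ → V) := {w | ∀ i ≤ n, w i = c i}

/-- The first `n + 1` vertices of a path. -/
def pathPrefix (n : ℕ) (w : ℕ → V) : Fin (n + 1) → V := fun i => w i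

/-- The path seen from time `n` on. -/
def pathShift (n : ℕ) (w : ℕ → V) : ℕ → V := fun k => w (n + k)

lemma pathPrefix_preimage_singleton (n : ℕ) (c : ℕ → V) :
    pathPrefix n ⁻¹' {pathPrefix n c} = pathCylinder n c := by
  ext w
  simp only [Set.mem_preimage, Set.mem_singleton_iff, pathCylinder, Set.mem_ofPred_eq, funext_iff,
    pathPrefix]
  exact ⟨fun h i hi => h ⟨i, by omega⟩, fun h i => h i (by omega)⟩

lemma exists_pathPrefix_eq (n : ℕ) (d : Fin (n + 1) → V) : ∃ c : ℕ → V, pathPrefix n c = d := by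
  refine ⟨fun i => if h : i < n + 1 then d ⟨i, h⟩ else d 0, ?_⟩
  funext i
  exact dif_pos i.isLt

lemma isPiSystem_pathCylinder :
    IsPiSystem {s : Set (ℕ → V) | ∃ n c, s = pathCylinder n c} := by
  rintro _ ⟨n, c, rfl⟩ _ ⟨m, d, rfl⟩ ⟨w, hw, hw'⟩
  refine ⟨max n m, w, ?_⟩
  ext u
  refine ⟨fun ⟨h, h'⟩ i hi => ?_, fun h => ⟨fun i hi => ?_, fun i hi => ?_⟩⟩
  · rcases le_max_iff.1 hi with hi | hi
    · rw [h i hi, hw i hi]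
    · rw [h' i hi, hw' i hi]
  · rw [h i (hi.trans (le_max_left _ _)), hw i hi]
  · rw [h i (hi.trans (le_max_right _ _)), hw' i hi]

variable [MeasurableSpace V]

lemma measurable_pathPrefix (n : ℕ) : Measurable (pathPrefix (V := V) n) :=
  measurable_pi_lambda _ fun _ => measurable_pi_apply _

lemma measurable_pathShift (n : ℕ) : Measurable (pathShift (V := V) n) :=
  measurable_pi_lambda _ fun _ => measurable_pi_apply _

variable [Countable V] [DiscreteMeasurableSpace V]

lemma measurableSet_pathCylinder (n : ℕ) (c : ℕ → V) : MeasurableSet (pathCylinder n c) := by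
  rw [← pathPrefix_preimage_singleton]
  exact measurable_pathPrefix n (measurableSet_singleton _)

lemma generateFrom_pathCylinder :
    (MeasurableSpace.pi : MeasurableSpace (ℕ → V)) =
      MeasurableSpace.generateFrom {s | ∃ n c, s = pathCylinder n c} := by
  apply le_antisymm
  · refine iSup_le fun i => ?_
    rintro _ ⟨t, -, rfl⟩
    have : (fun w : ℕ → V => w i) ⁻¹' t =
        ⋃ d ∈ {d : Fin (i + 1) → V | d (Fin.last i) ∈ t}, pathPrefix i ⁻¹' {d} := by
      ext w
      simp [pathPrefix]
    rw [this]
    refine MeasurableSet.biUnion (Set.to_countable _) fun d _ => ?_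
    obtain ⟨c, rfl⟩ := exists_pathPrefix_eq i d
    exact MeasurableSpace.measurableSet_generateFrom ⟨i, c, pathPrefix_preimage_singleton i c⟩
  · refine MeasurableSpace.generateFrom_le ?_
    rintro _ ⟨n, c, rfl⟩
    exact measurableSet_pathCylinder n c

end PathSpace

lemma measurableSet_hits {V : Type*} [MeasurableSpace V] [DiscreteMeasurableSpace V]
    (K : Set V) : MeasurableSet (hits K) := by
  have : hits K = ⋃ n, (fun w : ℕ → V => w n) ⁻¹' K := by
    ext w
    simp [hits]
  rw [this]
  exact MeasurableSet.iUnion fun n => measurable_pi_apply n MeasurableSet.of_discrete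

section Markov

variable {V : Type*} [MeasurableSpace V]

open Classical in
/-- `P` is the family of path laws of the Markov chain with transition probabilities `p`. -/
def IsPathLaw (p : V → V → ENNReal) (P : V → Measure (ℕ → V)) : Prop :=
  ∀ (x : V) (n : ℕ) (c : ℕ → V), P x (pathCylinder n c) =
    (if c 0 = x then 1 else 0) * ∏ i ∈ Finset.range n, p (c i) (c (i + 1))

variable {p : V → V → ENNReal} {P : V → Measure (ℕ → V)}

lemma IsPathLaw.measure_pathCylinder_inter_shift_pathCylinder (hP : IsPathLaw p P) (z : V)
    (n : ℕ) (c : ℕ → V) (k : ℕ) (d : ℕ → V) :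
    P z (pathCylinder n c ∩ pathShift n ⁻¹' pathCylinder k d) =
      P z (pathCylinder n c) * P (c n) (pathCylinder k d) := by
  by_cases hd : d 0 = c n
  · have hset : pathCylinder n c ∩ pathShift n ⁻¹' pathCylinder k d =
        pathCylinder (n + k) (fun i => if i ≤ n then c i else d (i - n)) := by
      ext w
      simp only [pathCylinder, pathShift, Set.mem_inter_iff, Set.mem_preimage, Set.mem_ofPred_eq]
      refine ⟨fun ⟨h, h'⟩ i hi => ?_, fun h => ⟨fun i hi => ?_, fun i hi => ?_⟩⟩
      · split_ifs with hin
        · exact h i hin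
        · rw [← h' (i - n) (by omega)]
          congr 1
          omega
      · rw [h i (by omega), if_pos hi]
      · rw [h (n + i) (by omega)]
        rcases Nat.eq_zero_or_pos i with rfl | hi0
        · simp [hd]
        · rw [if_neg (by omega), Nat.add_sub_cancel_left]
    rw [hset, hP, hP, hP, Finset.prod_range_add, if_pos hd, one_mul, if_pos (Nat.zero_le n),
      mul_assoc]
    congr 2
    · refine Finset.prod_congr rfl fun i hi => ?_
      have := Finset.mem_range.1 hi
      rw [if_pos (by omega), if_pos (by omega)]
    · refine Finset.prod_congr rfl fun i _ => ?_
      rw [if_neg (by omega : ¬ n + i + 1 ≤ n), show n + i + 1 - n = i + 1 by omega]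
      rcases Nat.eq_zero_or_pos i with rfl | hi0
      · simp [hd]
      · rw [if_neg (by omega), Nat.add_sub_cancel_left]
  · have hset : pathCylinder n c ∩ pathShift n ⁻¹' pathCylinder k d = ∅ := by
      ext w
      simp only [pathCylinder, pathShift, Set.mem_inter_iff, Set.mem_preimage, Set.mem_ofPred_eq,
        Set.mem_empty_iff_false, iff_false]
      rintro ⟨h, h'⟩
      exact hd ((h' 0 (Nat.zero_le k)).symm.trans (h n le_rfl))
    rw [hset, hP (c n), if_neg hd]
    simp

variable [Countable V] [DiscreteMeasurableSpace V]

/-- The Markov property at a deterministic time. -/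
lemma IsPathLaw.measure_pathCylinder_inter_shift (hP : IsPathLaw p P)
    (hprob : ∀ x, IsProbabilityMeasure (P x)) (z : V) (n : ℕ) (c : ℕ → V) {H : Set (ℕ → V)}
    (hH : MeasurableSet H) :
    P z (pathCylinder n c ∩ pathShift n ⁻¹' H) = P z (pathCylinder n c) * P (c n) H := by
  have hmap (S : Set (ℕ → V)) (hS : MeasurableSet S) :
      (((P z).restrict (pathCylinder n c)).map (pathShift n)) S =
        P z (pathCylinder n c ∩ pathShift n ⁻¹' S) := by
    rw [Measure.map_apply (measurable_pathShift n) hS,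
      Measure.restrict_apply (measurable_pathShift n hS), Set.inter_comm]
  have key : ((P z).restrict (pathCylinder n c)).map (pathShift n) =
      P z (pathCylinder n c) • P (c n) := by
    refine ext_of_generate_finite _ generateFrom_pathCylinder isPiSystem_pathCylinder ?_ ?_
    · rintro _ ⟨k, d, rfl⟩
      rw [hmap _ (measurableSet_pathCylinder k d),
        hP.measure_pathCylinder_inter_shift_pathCylinder, Measure.smul_apply, smul_eq_mul]
    · rw [hmap _ MeasurableSet.univ]
      simp
  rw [← hmap H hH, key, Measure.smul_apply, smul_eq_mul]

lemma IsPathLaw.mul_measure_prefix_le (hP : IsPathLaw p P)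
    (hprob : ∀ x, IsProbabilityMeasure (P x)) (z : V) (n : ℕ) {H : Set (ℕ → V)}
    (hH : MeasurableSet H) (F : Set (Fin (n + 1) → V)) {r : ENNReal}
    (hF : ∀ d ∈ F, r ≤ P (d (Fin.last n)) H) :
    r * P z (pathPrefix n ⁻¹' F) ≤ P z (pathPrefix n ⁻¹' F ∩ pathShift n ⁻¹' H) := by
  have hpre := measurable_pathPrefix (V := V) n
  have hFm : MeasurableSet F := F.to_countable.measurableSet
  have h₁ : P z (pathPrefix n ⁻¹' F) = (P z).map (pathPrefix n) F :=
    (Measure.map_apply hpre hFm).symm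
  have h₂ : P z (pathPrefix n ⁻¹' F ∩ pathShift n ⁻¹' H) =
      ((P z).restrict (pathShift n ⁻¹' H)).map (pathPrefix n) F := by
    rw [Measure.map_apply hpre hFm, Measure.restrict_apply (hpre hFm)]
  rw [h₁, h₂, ← Measure.tsum_indicator_apply_singleton _ F hFm,
    ← Measure.tsum_indicator_apply_singleton _ F hFm, ← ENNReal.tsum_mul_left]
  refine ENNReal.tsum_le_tsum fun d => ?_
  by_cases hd : d ∈ F
  · rw [Set.indicator_of_mem hd, Set.indicator_of_mem hd,
      Measure.map_apply hpre (measurableSet_singleton d),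
      Measure.map_apply hpre (measurableSet_singleton d),
      Measure.restrict_apply (hpre (measurableSet_singleton d))]
    obtain ⟨c, rfl⟩ := exists_pathPrefix_eq n d
    rw [pathPrefix_preimage_singleton, hP.measure_pathCylinder_inter_shift hprob z n c hH, mul_comm]
    gcongr
    exact hF _ hd
  · simp [hd]

/-- If `H` has probability at least `r` from every vertex of `D`, then with conditional probability
at least `r`, a visit to `D` at or after time `m` is followed by a future belonging to `H`. -/
lemma IsPathLaw.mul_measure_visit_le (hP : IsPathLaw p P)
    (hprob : ∀ x, IsProbabilityMeasure (P x)) (z : V) (m : ℕ) {H : Set (ℕ → V)}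
    (hH : MeasurableSet H) (D : Set V) {r : ENNReal} (hD : ∀ y ∈ D, r ≤ P y H) :
    r * P z {w | ∃ n ≥ m, w n ∈ D} ≤ P z {w | ∃ n ≥ m, pathShift n w ∈ H} := by
  let F (n : ℕ) : Set (Fin (n + 1) → V) :=
    {d | m ≤ n ∧ d (Fin.last n) ∈ D ∧ ∀ i : Fin (n + 1), m ≤ i → (i : ℕ) < n → d i ∉ D}
  have hcover : {w : ℕ → V | ∃ n ≥ m, w n ∈ D} ⊆ ⋃ n, pathPrefix n ⁻¹' F n := by
    classical
    intro w hw
    refine Set.mem_iUnion.2 ⟨Nat.find hw, (Nat.find_spec hw).1, (Nat.find_spec hw).2, ?_⟩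
    exact fun i hi hlt hiD => Nat.find_min hw hlt ⟨hi, hiD⟩
  have hdisj : Pairwise (Function.onFun Disjoint
      fun n => pathPrefix n ⁻¹' F n ∩ pathShift n ⁻¹' H) := by
    refine (pairwise_disjoint_on _).2 fun i j hij => Set.disjoint_left.2 ?_
    rintro w ⟨⟨hmi, hiD, -⟩, -⟩ ⟨⟨-, -, hj⟩, -⟩
    exact hj ⟨i, by omega⟩ hmi hij hiD
  have hmeas (n : ℕ) : MeasurableSet (pathPrefix n ⁻¹' F n ∩ pathShift n ⁻¹' H) :=
    (measurable_pathPrefix n (F n).to_countable.measurableSet).inter (measurable_pathShift n hH)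
  calc r * P z {w | ∃ n ≥ m, w n ∈ D}
      ≤ r * ∑' n, P z (pathPrefix n ⁻¹' F n) := by
        gcongr
        exact (measure_mono hcover).trans (measure_iUnion_le _)
    _ = ∑' n, r * P z (pathPrefix n ⁻¹' F n) := ENNReal.tsum_mul_left.symm
    _ ≤ ∑' n, P z (pathPrefix n ⁻¹' F n ∩ pathShift n ⁻¹' H) :=
        ENNReal.tsum_le_tsum fun n =>
          hP.mul_measure_prefix_le hprob z n hH (F n) fun d hd => hD _ hd.2.1
    _ = P z (⋃ n, pathPrefix n ⁻¹' F n ∩ pathShift n ⁻¹' H) := (measure_iUnion hdisj hmeas).symm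
    _ ≤ P z {w | ∃ n ≥ m, pathShift n w ∈ H} :=
        measure_mono (Set.iUnion_subset fun n w hw => ⟨n, hw.1.1, hw.2⟩)

end Markov

lemma tendsto_measure_visit_atTop_zero {V : Type*} [MeasurableSpace V] [DiscreteMeasurableSpace V]
    (μ : Measure (ℕ → V)) [IsFiniteMeasure μ] (K : Set V)
    (hfin : ∀ᵐ w ∂μ, {n : ℕ | w n ∈ K}.Finite) :
    Tendsto (fun m => μ {w | ∃ n ≥ m, w n ∈ K}) atTop (nhds 0) := by
  have hmeas (m : ℕ) : MeasurableSet {w : ℕ → V | ∃ n ≥ m, w n ∈ K} := by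
    have : {w : ℕ → V | ∃ n ≥ m, w n ∈ K} = ⋃ n ≥ m, (fun w : ℕ → V => w n) ⁻¹' K := by
      ext w
      simp
    rw [this]
    exact MeasurableSet.iUnion fun n => MeasurableSet.iUnion fun _ =>
      measurable_pi_apply n MeasurableSet.of_discrete
  have hzero : μ (⋂ m, {w : ℕ → V | ∃ n ≥ m, w n ∈ K}) = 0 := by
    refine measure_mono_null (fun w hw => ?_) (ae_iff.1 hfin)
    refine Set.infinite_of_forall_exists_gt fun m => ?_
    obtain ⟨n, hn, hnK⟩ := Set.mem_iInter.1 hw (m + 1)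
    exact ⟨n, hnK, hn⟩
  rw [← hzero]
  refine tendsto_measure_iInter_atTop (fun m => (hmeas m).nullMeasurableSet) ?_
    ⟨0, measure_ne_top _ _⟩
  rintro i j hij w ⟨n, hn, h⟩
  exact ⟨n, hij.trans hn, h⟩

open ProbabilityTheory in
open Classical in
/-- Fix `x ∈ V` and `ε > 0`, and let `D = {y : P_y[τ_{{x}} < ∞] > ε}`. Then `D` is transient
for the chain: for every `z`, `P_z`-a.s. the walk visits `D` only finitely many times. -/
theorem hitting_level_set_transient
    {V : Type*} [Countable V] [MeasurableSpace V] [DiscreteMeasurableSpace V]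
    (G : SimpleGraph V) [G.LocallyFinite] (hconn : G.Connected)
    (a : V → V → ℝ)
    (hsymm : ∀ x y, a x y = a y x)
    (hpos : ∀ x y, G.Adj x y → 0 < a x y)
    (P : V → Measure (ℕ → V)) (hprob : ∀ x, IsProbabilityMeasure (P x))
    (hP : ∀ (x : V) (n : ℕ) (c : ℕ → V),
      P x {w | ∀ i ≤ n, w i = c i} =
        (if c 0 = x then 1 else 0) *
          ∏ i ∈ Finset.range n, ENNReal.ofReal (step G a (c i) (c (i + 1))))
    (htrans : ∀ x y : V, ∀ᵐ w ∂ P x, {n : ℕ | w n = y}.Finite)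
    (x : V) (ε : ℝ) (hε : 0 < ε) (z : V) :
    P z {w | {n : ℕ | ε < ((P (w n)) (hits ({x} : Set V))).toReal}.Infinite} = 0 := by
  have hlaw : IsPathLaw (fun u v => ENNReal.ofReal (step G a u v)) P := hP
  have hbound (m : ℕ) :
      ENNReal.ofReal ε * P z {w | {n : ℕ | ε < ((P (w n)) (hits ({x} : Set V))).toReal}.Infinite} ≤
        P z {w | ∃ n ≥ m, w n ∈ ({x} : Set V)} := by
    calc _ ≤ ENNReal.ofReal ε *
          P z {w | ∃ n ≥ m, w n ∈ {y | ε < ((P y) (hits ({x} : Set V))).toReal}} := by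
          gcongr with w
          intro hw
          obtain ⟨n, hn, hmn⟩ := Set.Infinite.exists_gt hw m
          exact ⟨n, hmn.le, hn⟩
      _ ≤ P z {w | ∃ n ≥ m, pathShift n w ∈ hits ({x} : Set V)} :=
          hlaw.mul_measure_visit_le hprob z m (measurableSet_hits _) _ fun y hy =>
            ENNReal.ofReal_le_of_le_toReal (le_of_lt hy)
      _ ≤ _ := by
          refine measure_mono ?_
          rintro w ⟨n, hn, k, hk⟩
          exact ⟨n + k, by omega, hk⟩
  have hle := ge_of_tendsto' (tendsto_measure_visit_atTop_zero (P z) {x} (htrans z x)) hbound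
  rcases mul_eq_zero.1 (le_antisymm hle zero_le) with h | h
  · exact absurd (ENNReal.ofReal_eq_zero.1 h) (not_le.2 hε)
  · exact h
end

section
/- Assume the Markov chain X is tail-trivial: for every x ∈ V, every measurable event A ⊆ V^ℕ that is invariant under the shift θ (θ((w_n)_{n≥0}) = (w_{n+1})_{n≥0}, invariance meaning θ^{-1}(A) = A) satisfies P_x(A) ∈ {0,1}. Then for every x, y ∈ V there exists a probability measure Q on V^ℕ × V^ℕ with first marginal P_x and second marginal P_y such that, Q-almost surely for the pair of paths (X, Y), there exist finite (random) times S, T ≥ 0 with X_{S+n} = Y_{T+n} for all n ≥ 0, i.e. the two paths coincide eventually up to time-shift. -/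
open MeasureTheory Filter

namespace MeasureTheory.Measure

open ProbabilityTheory

variable {X Y : Type*} [MeasurableSpace X] [MeasurableSpace Y]

theorem le_of_add_le_add_right {μ₁ μ₂ ν : Measure X} [IsFiniteMeasure ν]
    (h : μ₁ + ν ≤ μ₂ + ν) : μ₁ ≤ μ₂ := fun s =>
  (ENNReal.add_le_add_iff_right (measure_ne_top ν s)).1 (h s)

/-- A measure below the image of `μ` is itself the image of a measure below `μ`. -/
theorem exists_le_map_eq {μ : Measure X} [IsFiniteMeasure μ] {f : X → Y}
    (hf : Measurable f) {l : Measure Y} (hl : l ≤ μ.map f) :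
    ∃ μ' ≤ μ, μ'.map f = l := by
  have : IsFiniteMeasure l := isFiniteMeasure_of_le _ hl
  set u := l.rnDeriv (μ.map f)
  have hu : Measurable u := Measure.measurable_rnDeriv _ _
  refine ⟨μ.withDensity (u ∘ f), ?_, ?_⟩
  · have h1 : u ∘ f ≤ᵐ[μ] 1 :=
      ae_of_ae_map hf.aemeasurable (Measure.rnDeriv_le_one_of_le hl)
    calc μ.withDensity (u ∘ f) ≤ μ.withDensity 1 := withDensity_mono h1
      _ = μ := withDensity_one
  · rw [← Measure.withDensity_rnDeriv_eq l (μ.map f) (Measure.absolutelyContinuous_of_le hl)]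
    ext s hs
    rw [Measure.map_apply hf hs, withDensity_apply _ (hf hs), withDensity_apply _ hs,
      setLIntegral_map hs hu hf]
    rfl

/-- If the forward images of `μ` under `θ` are singular to those of `ν`, and `μ` and `ν` agree on
`θ`-invariant sets, then both vanish. -/
theorem eq_zero_of_mutuallySingular_iterate {θ : X → X} (hθ : Measurable θ) {μ ν : Measure X}
    (hsing : ∀ s t, μ.map θ^[s] ⟂ₘ ν.map θ^[t])
    (hinv : ∀ A, MeasurableSet A → θ ⁻¹' A = A → μ A = ν A) : μ = 0 ∧ ν = 0 := by
  have hms : Measure.sum (fun s => μ.map θ^[s]) ⟂ₘ Measure.sum (fun t => ν.map θ^[t]) := by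
    rw [MutuallySingular.sum_left]
    intro s
    rw [MutuallySingular.sum_right]
    exact hsing s
  obtain ⟨B, hB, hμB, hνB⟩ := hms
  rw [Measure.sum_apply_eq_zero] at hμB hνB
  have hμ : ∀ᵐ w ∂μ, ∀ s, θ^[s] w ∉ B := ae_all_iff.2 fun s => by
    have := hμB s
    rwa [Measure.map_apply (hθ.iterate s) hB, measure_eq_zero_iff_ae_notMem] at this
  have hν : ∀ᵐ w ∂ν, ∀ s, θ^[s] w ∈ B := ae_all_iff.2 fun s => by
    have := hνB s
    rw [Measure.map_apply (hθ.iterate s) hB.compl, measure_eq_zero_iff_ae_notMem] at this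
    filter_upwards [this] with w hw using by simpa using hw
  let A : Set X := ⋂ n, ⋃ s ≥ n, θ^[s] ⁻¹' B
  have hA : MeasurableSet A := .iInter fun n => .iUnion fun s => .iUnion fun _ => hθ.iterate s hB
  have hAinv : θ ⁻¹' A = A := by
    ext w
    simp only [A, Set.mem_preimage, Set.mem_iInter, Set.mem_iUnion, ← Function.iterate_succ_apply,
      exists_prop]
    constructor
    · intro h n
      obtain ⟨s, hs, hw⟩ := h n
      exact ⟨s + 1, by omega, hw⟩
    · intro h n
      obtain ⟨s, hs, hw⟩ := h (n + 1)
      obtain ⟨s, rfl⟩ : ∃ r, s = r + 1 := ⟨s - 1, by omega⟩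
      exact ⟨s, by omega, hw⟩
  have hμA : μ A = 0 := by
    rw [measure_eq_zero_iff_ae_notMem]
    filter_upwards [hμ] with w hw hwA
    obtain ⟨s, -, hs⟩ := Set.mem_iUnion₂.1 (Set.mem_iInter.1 hwA 0)
    exact hw s hs
  have hνA : ν Aᶜ = 0 := by
    rw [measure_eq_zero_iff_ae_notMem]
    filter_upwards [hν] with w hw hwA
    exact hwA (Set.mem_iInter.2 fun n => Set.mem_iUnion₂.2 ⟨n, le_rfl, hw n⟩)
  have hν0 : ν Set.univ = 0 := by
    rw [← measure_add_measure_compl hA, ← hinv A hA hAinv, hμA, hνA, add_zero]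
  have hμ0 : μ Set.univ = 0 := by rw [hinv _ .univ rfl, hν0]
  exact ⟨measure_univ_eq_zero.1 hμ0, measure_univ_eq_zero.1 hν0⟩

variable [StandardBorelSpace X] [StandardBorelSpace Y]

/-- Two measures with the same image can be coupled along the fibers. -/
theorem exists_coupling_of_map_eq [Nonempty X] {μ ν : Measure X}
    [IsFiniteMeasure μ] [IsFiniteMeasure ν] {f g : X → Y} (hf : Measurable f) (hg : Measurable g)
    (h : μ.map f = ν.map g) :
    ∃ Q : Measure (X × X), Q.map Prod.fst = μ ∧ Q.map Prod.snd = ν ∧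
      ∀ᵐ q ∂Q, f q.1 = g q.2 := by
  have fiber : ∀ {m : Measure X} [IsFiniteMeasure m] {k : X → Y}, Measurable k →
      ∀ᵐ z ∂(m.map k), ∀ᵐ w ∂(condDistrib id k m z), k w = z := by
    intro m _ k hk
    have h1 : ∀ᵐ p ∂((m.map k) ⊗ₘ condDistrib id k m), k p.2 = p.1 := by
      rw [compProd_map_condDistrib aemeasurable_id]
      rw [ae_map_iff (by fun_prop) (measurableSet_eq_fun (by fun_prop) (by fun_prop))]
      exact ae_of_all _ fun _ => rfl
    exact Measure.ae_ae_of_ae_compProd h1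
  set κ := condDistrib id f μ
  set η := condDistrib id g ν
  have hκ : κ ∘ₘ μ.map f = μ := by
    rw [condDistrib_comp_map hf.aemeasurable aemeasurable_id, Measure.map_id]
  have hη : η ∘ₘ μ.map f = ν := by
    rw [h, condDistrib_comp_map hg.aemeasurable aemeasurable_id, Measure.map_id]
  refine ⟨(κ ×ₖ η) ∘ₘ μ.map f, ?_, ?_, ?_⟩
  · rw [Measure.map_comp _ _ measurable_fst, ← Kernel.fst_eq, Kernel.fst_prod, hκ]
  · rw [Measure.map_comp _ _ measurable_snd, ← Kernel.snd_eq, Kernel.snd_prod, hη]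
  · rw [Measure.ae_comp_iff (measurableSet_eq_fun (by fun_prop) (by fun_prop))]
    have h2 := fiber (m := ν) hg
    rw [← h] at h2
    filter_upwards [fiber (m := μ) hf, h2] with z h1 h2
    rw [Kernel.prod_apply]
    have e1 : ∀ᵐ q ∂((κ z).prod (η z)), f q.1 = z :=
      Measure.quasiMeasurePreserving_fst.ae h1
    have e2 : ∀ᵐ q ∂((κ z).prod (η z)), g q.2 = z :=
      Measure.quasiMeasurePreserving_snd.ae h2
    filter_upwards [e1, e2] with q h1 h2
    rw [h1, h2]

/-- The images of `μ` and `ν` can be matched as far as possible: what is left over has mutually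
singular images. -/
theorem exists_maximal_partial_coupling [Nonempty X] (μ ν : Measure X)
    [IsFiniteMeasure μ] [IsFiniteMeasure ν] {f g : X → Y} (hf : Measurable f) (hg : Measurable g) :
    ∃ Q : Measure (X × X), Q.map Prod.fst ≤ μ ∧ Q.map Prod.snd ≤ ν ∧
      (∀ᵐ q ∂Q, f q.1 = g q.2) ∧
      (μ - Q.map Prod.fst).map f ⟂ₘ (ν - Q.map Prod.snd).map g := by
  obtain ⟨μ', hμ', hfμ⟩ := Measure.exists_le_map_eq hf
    (inf_le_left : μ.map f ⊓ ν.map g ≤ μ.map f)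
  obtain ⟨ν', hν', hgν⟩ := Measure.exists_le_map_eq hg
    (inf_le_right : μ.map f ⊓ ν.map g ≤ ν.map g)
  have : IsFiniteMeasure μ' := isFiniteMeasure_of_le _ hμ'
  have : IsFiniteMeasure ν' := isFiniteMeasure_of_le _ hν'
  obtain ⟨Q, h1, h2, h3⟩ := Measure.exists_coupling_of_map_eq hf hg (hfμ.trans hgν.symm)
  refine ⟨Q, h1.trans_le hμ', h2.trans_le hν', h3, ?_⟩
  rw [h1, h2]
  have a1 : (μ - μ').map f + μ.map f ⊓ ν.map g = μ.map f := by
    conv_lhs => rw [← hfμ]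
    rw [← Measure.map_add _ _ hf, Measure.sub_add_cancel_of_le hμ']
  have a2 : (ν - ν').map g + μ.map f ⊓ ν.map g = ν.map g := by
    conv_lhs => rw [← hgν]
    rw [← Measure.map_add _ _ hg, Measure.sub_add_cancel_of_le hν']
  have : IsFiniteMeasure (μ.map f ⊓ ν.map g) := isFiniteMeasure_of_le _ inf_le_left
  apply Measure.mutuallySingular_of_disjoint
  intro ρ hρ1 hρ2
  have hle : ρ + μ.map f ⊓ ν.map g ≤ 0 + μ.map f ⊓ ν.map g := by
    rw [zero_add]
    refine le_inf ?_ ?_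
    · calc _ ≤ (μ - μ').map f + μ.map f ⊓ ν.map g := by gcongr
        _ = _ := a1
    · calc _ ≤ (ν - ν').map g + μ.map f ⊓ ν.map g := by gcongr
        _ = _ := a2
  exact Measure.le_of_add_le_add_right hle

/-- Partial coupling of `μ` and `ν` that is maximal simultaneously for all pairs `(f k, g k)`. -/
theorem exists_maximal_partial_coupling_seq [Nonempty X] (μ ν : Measure X)
    [IsFiniteMeasure μ] [IsFiniteMeasure ν] {f g : ℕ → X → Y} (hf : ∀ k, Measurable (f k))
    (hg : ∀ k, Measurable (g k)) :
    ∃ Q : Measure (X × X), Q.map Prod.fst ≤ μ ∧ Q.map Prod.snd ≤ ν ∧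
      (∀ᵐ q ∂Q, ∃ k, f k q.1 = g k q.2) ∧
      ∀ k, (μ - Q.map Prod.fst).map (f k) ⟂ₘ (ν - Q.map Prod.snd).map (g k) := by
  have hstep : ∀ (Q : Measure (X × X)) (k : ℕ), ∃ D : Measure (X × X),
      D.map Prod.fst ≤ μ - Q.map Prod.fst ∧ D.map Prod.snd ≤ ν - Q.map Prod.snd ∧
      (∀ᵐ q ∂D, f k q.1 = g k q.2) ∧
      (μ - Q.map Prod.fst - D.map Prod.fst).map (f k) ⟂ₘ
        (ν - Q.map Prod.snd - D.map Prod.snd).map (g k) := fun Q k =>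
    Measure.exists_maximal_partial_coupling _ _ (hf k) (hg k)
  choose D hD1 hD2 hD3 hD4 using hstep
  obtain ⟨C, hC0, hCs⟩ : ∃ C : ℕ → Measure (X × X), C 0 = 0 ∧ ∀ k, C (k + 1) = C k + D (C k) k :=
    ⟨fun n => Nat.rec 0 (fun k Q => Q + D Q k) n, rfl, fun _ => rfl⟩
  have hCsum : ∀ n, C n = ∑ k ∈ Finset.range n, D (C k) k := by
    intro n
    induction n with
    | zero => simp [hC0]
    | succ n ih => rw [hCs, Finset.sum_range_succ, ← ih]
  have hCle : ∀ n, (C n).map Prod.fst ≤ μ ∧ (C n).map Prod.snd ≤ ν := by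
    intro n
    induction n with
    | zero => simp [hC0, Measure.zero_le]
    | succ n ih =>
      have i1 : IsFiniteMeasure ((C n).map Prod.fst) := isFiniteMeasure_of_le _ ih.1
      have i2 : IsFiniteMeasure ((C n).map Prod.snd) := isFiniteMeasure_of_le _ ih.2
      rw [hCs, Measure.map_add _ _ measurable_fst, Measure.map_add _ _ measurable_snd]
      constructor
      · rw [add_comm]
        calc _ ≤ μ - (C n).map Prod.fst + (C n).map Prod.fst := add_le_add_left (hD1 _ _) _
          _ = μ := Measure.sub_add_cancel_of_le ih.1
      · rw [add_comm]
        calc _ ≤ ν - (C n).map Prod.snd + (C n).map Prod.snd := add_le_add_left (hD2 _ _) _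
          _ = ν := Measure.sub_add_cancel_of_le ih.2
  let Q : Measure (X × X) := Measure.sum fun k => D (C k) k
  have hsum_le : ∀ (p : X × X → X) (ρ : Measure X), Measurable p →
      (∀ n, (C n).map p ≤ ρ) → Q.map p ≤ ρ := by
    intro p ρ hp h
    rw [Measure.le_iff]
    intro s hs
    rw [Measure.map_apply hp hs, Measure.sum_apply _ (hp hs)]
    refine ENNReal.tsum_le_of_sum_range_le fun n => ?_
    have := h n s
    rwa [Measure.map_apply hp hs, hCsum, Measure.finsetSum_apply] at this
  have hCQ : ∀ n, C n ≤ Q := by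
    intro n
    rw [Measure.le_iff]
    intro s hs
    rw [hCsum, Measure.finsetSum_apply, Measure.sum_apply _ hs]
    exact ENNReal.sum_le_tsum _
  refine ⟨Q, hsum_le _ _ measurable_fst fun n => (hCle n).1,
    hsum_le _ _ measurable_snd fun n => (hCle n).2, ?_, ?_⟩
  · rw [Measure.ae_sum_iff]
    intro k
    filter_upwards [hD3 (C k) k] with q hq using ⟨k, hq⟩
  · have hsub : ∀ (p : X × X → X) (ρ : Measure X), Measurable p → IsFiniteMeasure ρ →
        Q.map p ≤ ρ → ∀ k, ρ - Q.map p ≤ ρ - (C k).map p - (D (C k) k).map p := by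
      intro p ρ hp _ hle k
      have i0 : IsFiniteMeasure (Q.map p) := isFiniteMeasure_of_le _ hle
      have hmono : (C (k + 1)).map p ≤ Q.map p := Measure.map_mono (hCQ (k + 1)) hp
      have hk : (C k).map p + (D (C k) k).map p ≤ ρ := by
        rw [← Measure.map_add _ _ hp, ← hCs]
        exact hmono.trans hle
      have hk1 : (C k).map p ≤ ρ := (Measure.le_add_right le_rfl).trans hk
      have i1 : IsFiniteMeasure ((C k).map p) := isFiniteMeasure_of_le _ hk1
      have i2 : IsFiniteMeasure ((D (C k) k).map p) :=
        isFiniteMeasure_of_le ρ ((Measure.le_add_left le_rfl).trans hk)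
      refine Measure.sub_le_of_le_add ?_
      have hk2 : (D (C k) k).map p ≤ ρ - (C k).map p := by
        refine Measure.le_of_add_le_add_right (ν := (C k).map p) (le_of_le_of_eq ?_
          (Measure.sub_add_cancel_of_le hk1).symm)
        rwa [add_comm (Measure.map p (D (C k) k))]
      calc ρ = ρ - (C k).map p - (D (C k) k).map p + (C (k + 1)).map p := by
            rw [hCs, Measure.map_add _ _ hp, add_comm (Measure.map p (C k)), ← add_assoc,
              Measure.sub_add_cancel_of_le hk2, Measure.sub_add_cancel_of_le hk1]
        _ ≤ _ := by gcongr
    intro k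
    refine (hD4 (C k) k).mono (Measure.map_mono (hsub _ _ measurable_fst ‹_› ?_ k) (hf k))
      (Measure.map_mono (hsub _ _ measurable_snd ‹_› ?_ k) (hg k))
    · exact hsum_le _ _ measurable_fst fun n => (hCle n).1
    · exact hsum_le _ _ measurable_snd fun n => (hCle n).2

/-- Two probability measures that agree on `θ`-invariant sets have a coupling under which the
forward orbits merge up to a time-shift. -/
theorem exists_shift_coupling {θ : X → X} (hθ : Measurable θ) {μ ν : Measure X}
    [IsProbabilityMeasure μ] [IsProbabilityMeasure ν]
    (hinv : ∀ A, MeasurableSet A → θ ⁻¹' A = A → μ A = ν A) :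
    ∃ Q : Measure (X × X), Q.map Prod.fst = μ ∧ Q.map Prod.snd = ν ∧
      ∀ᵐ q ∂Q, ∃ s t, θ^[s] q.1 = θ^[t] q.2 := by
  have : Nonempty X := nonempty_of_isProbabilityMeasure μ
  obtain ⟨Q, h1, h2, hR, hsing⟩ := exists_maximal_partial_coupling_seq μ ν
    (f := fun k => θ^[k.unpair.1]) (g := fun k => θ^[k.unpair.2])
    (fun k => hθ.iterate _) (fun k => hθ.iterate _)
  have hR' : ∀ᵐ q ∂Q, ∃ s t, θ^[s] q.1 = θ^[t] q.2 := by
    filter_upwards [hR] with q ⟨k, hk⟩ using ⟨_, _, hk⟩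
  have i1 : IsFiniteMeasure (Q.map Prod.fst) := isFiniteMeasure_of_le _ h1
  have i2 : IsFiniteMeasure (Q.map Prod.snd) := isFiniteMeasure_of_le _ h2
  have hQinv : ∀ A, MeasurableSet A → θ ⁻¹' A = A → Q.map Prod.fst A = Q.map Prod.snd A := by
    intro A hA hAinv
    have hiter : ∀ n w, θ^[n] w ∈ A ↔ w ∈ A := by
      intro n w
      induction n with
      | zero => rfl
      | succ n ih => rw [Function.iterate_succ_apply', ← Set.mem_preimage, hAinv, ih]
    rw [Measure.map_apply measurable_fst hA, Measure.map_apply measurable_snd hA]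
    refine measure_congr ?_
    filter_upwards [hR'] with q ⟨s, t, hst⟩
    refine propext ?_
    change q.1 ∈ A ↔ q.2 ∈ A
    rw [← hiter s, hst, hiter]
  obtain ⟨z1, z2⟩ := eq_zero_of_mutuallySingular_iterate hθ
    (μ := μ - Q.map Prod.fst) (ν := ν - Q.map Prod.snd)
    (fun s t => by simpa using hsing (Nat.pair s t))
    (fun A hA hAinv => by
      rw [Measure.sub_apply hA h1, Measure.sub_apply hA h2, hinv A hA hAinv, hQinv A hA hAinv])
  refine ⟨Q, ?_, ?_, hR'⟩
  · rw [← Measure.sub_add_cancel_of_le h1, z1, zero_add]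
  · rw [← Measure.sub_add_cancel_of_le h2, z2, zero_add]

end MeasureTheory.Measure

section CylinderSets

variable {V : Type*} [Countable V] [MeasurableSpace V] [DiscreteMeasurableSpace V]

theorem measurableSet_pathCylinder_s14 (n : ℕ) (c : ℕ → V) :
    MeasurableSet {w : ℕ → V | ∀ i ≤ n, w i = c i} := by
  have : {w : ℕ → V | ∀ i ≤ n, w i = c i} = ⋂ i ≤ n, (fun w => w i) ⁻¹' {c i} := by
    ext w; simp
  rw [this]
  exact .iInter fun i => .iInter fun _ => measurable_pi_apply i (.singleton _)

/-- Finite measures on path space that agree on cylinder sets are equal. -/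
theorem MeasureTheory.Measure.ext_of_pathCylinder {μ ν : Measure (ℕ → V)} [IsFiniteMeasure μ]
    (h : ∀ (n : ℕ) (c : ℕ → V), μ {w | ∀ i ≤ n, w i = c i} = ν {w | ∀ i ≤ n, w i = c i}) :
    μ = ν := by
  rcases isEmpty_or_nonempty V with hV | hV
  · have : IsEmpty (ℕ → V) := ⟨fun w => hV.false (w 0)⟩
    ext s -
    simp [Set.eq_empty_of_isEmpty s]
  obtain ⟨v, hv⟩ := exists_surjective_nat V
  let C : Set (Set (ℕ → V)) := {s | ∃ (n : ℕ) (c : ℕ → V), s = {w | ∀ i ≤ n, w i = c i}}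
  refine Measure.ext_of_generateFrom_of_iUnion C (fun k => {w | ∀ i ≤ 0, w i = v k})
    ?_ ?_ ?_ ?_ ?_ ?_
  · apply le_antisymm
    · refine iSup_le fun n => ?_
      rw [← measurable_iff_comap_le]
      refine @measurable_to_countable' _ _ _ _ (MeasurableSpace.generateFrom C) _ fun z => ?_
      have : (fun w : ℕ → V => w n) ⁻¹' {z} =
          ⋃ c : Finset.range n → V, {w | ∀ i ≤ n, w i =
            if h : i ∈ Finset.range n then c ⟨i, h⟩ else z} := by
        ext w
        simp only [Set.mem_preimage, Set.mem_singleton_iff, Set.mem_iUnion, Set.mem_ofPred_eq]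
        constructor
        · intro hw
          refine ⟨fun i => w i, fun i hi => ?_⟩
          split_ifs with h
          · rfl
          · rw [← hw, show i = n by simp at h; omega]
        · rintro ⟨c, hc⟩
          simpa using hc n le_rfl
      rw [this]
      exact .iUnion fun c => .basic _ ⟨n, _, rfl⟩
    · refine MeasurableSpace.generateFrom_le ?_
      rintro _ ⟨n, c, rfl⟩
      exact measurableSet_pathCylinder_s14 n c
  · have key : ∀ (n m : ℕ) (c d : ℕ → V), n ≤ m →
        ({w : ℕ → V | ∀ i ≤ n, w i = c i} ∩ {w | ∀ i ≤ m, w i = d i}).Nonempty →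
        {w : ℕ → V | ∀ i ≤ n, w i = c i} ∩ {w | ∀ i ≤ m, w i = d i} =
          {w | ∀ i ≤ m, w i = d i} := by
      rintro n m c d hnm ⟨u, hu, hu'⟩
      refine Set.inter_eq_right.2 fun w hw i hi => ?_
      rw [hw i (hi.trans hnm), ← hu' i (hi.trans hnm), hu i hi]
    rintro _ ⟨n, c, rfl⟩ _ ⟨m, d, rfl⟩ hne
    rcases le_total n m with hnm | hnm
    · exact ⟨m, d, key n m c d hnm hne⟩
    · rw [Set.inter_comm] at hne ⊢
      exact ⟨n, c, key m n d c hnm hne⟩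
  · refine Set.eq_univ_of_forall fun w => ?_
    obtain ⟨k, hk⟩ := hv (w 0)
    exact Set.mem_iUnion.2 ⟨k, fun i hi => by rw [hk, Nat.le_zero.1 hi]⟩
  · exact fun k => ⟨0, fun _ => v k, rfl⟩
  · exact fun k => measure_ne_top _ _
  · rintro _ ⟨n, c, rfl⟩
    exact h n c

open Classical in
/-- Simple Markov property at time one, for a measure given by transition probabilities `p`. -/
theorem map_shift_restrict_eq_smul {p : V → V → ENNReal} {P : V → Measure (ℕ → V)}
    [∀ x, IsProbabilityMeasure (P x)]
    (hP : ∀ (x : V) (n : ℕ) (c : ℕ → V),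
      P x {w | ∀ i ≤ n, w i = c i} = (if c 0 = x then 1 else 0) *
        ∏ i ∈ Finset.range n, p (c i) (c (i + 1))) (x z : V) :
    ((P x).restrict {w | w 1 = z}).map (fun w n => w (n + 1)) = p x z • P z := by
  have hshift : Measurable (fun (w : ℕ → V) (n : ℕ) => w (n + 1)) := by fun_prop
  have hx : ∀ᵐ w ∂P x, w 0 = x := by
    have h0 := hP x 0 fun _ => x
    have hm : MeasurableSet {w : ℕ → V | w 0 = x} :=
      (measurableSet_singleton x).preimage (measurable_pi_apply 0)
    refine (mem_ae_iff_prob_eq_one hm).2 ?_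
    simpa using h0
  refine Measure.ext_of_pathCylinder fun n c => ?_
  have hm := hshift (measurableSet_pathCylinder_s14 n c)
  rw [Measure.map_apply hshift (measurableSet_pathCylinder_s14 n c), Measure.restrict_apply hm,
    Measure.smul_apply, smul_eq_mul, hP]
  by_cases hc : c 0 = z
  · subst hc
    let d : ℕ → V := fun i => Nat.casesOn i x c
    have : ((fun (w : ℕ → V) (n : ℕ) => w (n + 1)) ⁻¹' {w | ∀ i ≤ n, w i = c i} ∩
        {w | w 1 = c 0} : Set (ℕ → V)) =ᵐ[P x]
          ({w | ∀ i ≤ n + 1, w i = d i} : Set (ℕ → V)) := by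
      filter_upwards [hx] with w hw
      refine propext ⟨?_, ?_⟩
      · rintro ⟨h, -⟩ (_ | i) hi
        · exact hw
        · exact h i (by omega)
      · intro h
        exact ⟨fun i hi => h (i + 1) (by omega), h 1 (by omega)⟩
    rw [measure_congr this, hP, Finset.prod_range_succ']
    simp [d, mul_comm]
  · rw [if_neg hc, zero_mul, mul_zero]
    convert measure_empty (μ := P x)
    refine Set.eq_empty_of_forall_notMem ?_
    rintro w ⟨h, h'⟩
    exact hc ((h 0 (Nat.zero_le _)).symm.trans h')

end CylinderSets

section RandomWalk

variable {V : Type*} {G : SimpleGraph V} [G.LocallyFinite] {a : V → V → ℝ}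

theorem step_pos (hpos : ∀ x y, G.Adj x y → 0 < a x y) {x z : V} (h : G.Adj x z) :
    0 < step G a x z := by
  rw [step, if_pos h]
  refine div_pos (hpos x z h) (Finset.sum_pos (fun y hy => hpos x y ?_) ⟨z, ?_⟩)
  · simpa using hy
  · simpa using h

variable [MeasurableSpace V]

/-- The probability of an invariant event of probability `0` or `1` does not depend on the starting
vertex. -/
theorem measure_eq_of_invariant (hconn : G.Connected) (hpos : ∀ x y, G.Adj x y → 0 < a x y)
    {P : V → Measure (ℕ → V)} [∀ x, IsProbabilityMeasure (P x)]
    (hP : ∀ (x z : V), ((P x).restrict {w | w 1 = z}).map (fun w n => w (n + 1)) =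
      ENNReal.ofReal (step G a x z) • P z)
    {A : Set (ℕ → V)} (hA : MeasurableSet A)
    (hinv : (fun (w : ℕ → V) (n : ℕ) => w (n + 1)) ⁻¹' A = A)
    (h01 : ∀ x, P x A = 0 ∨ P x A = 1) (x y : V) : P x A = P y A := by
  have hshift : Measurable (fun (w : ℕ → V) (n : ℕ) => w (n + 1)) := by fun_prop
  have hadj : ∀ u v, G.Adj u v → P u A = 0 → P v A = 0 := by
    intro u v huv hu
    have h1 := congrArg (fun m => m A) (hP u v)
    simp only [Measure.map_apply hshift hA, hinv, Measure.smul_apply, smul_eq_mul] at h1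
    rw [nonpos_iff_eq_zero.1 ((Measure.restrict_apply_le _ _).trans_eq hu)] at h1
    exact (mul_eq_zero.1 h1.symm).resolve_left
      (ENNReal.ofReal_pos.2 (step_pos hpos huv)).ne'
  have hreach : ∀ u v, P u A = 0 → P v A = 0 := by
    intro u v
    obtain ⟨p⟩ := hconn.preconnected u v
    induction p with
    | nil => exact id
    | cons h _ ih => exact fun hu => ih (hadj _ _ h hu)
  rcases h01 x with hx | hx <;> rcases h01 y with hy | hy
  · rw [hx, hy]
  · rw [hx, hreach x y hx]
  · rw [hy, hreach y x hy]
  · rw [hx, hy]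

end RandomWalk

theorem iterate_shift_apply {V : Type*} (s n : ℕ) (w : ℕ → V) :
    (fun (w : ℕ → V) (n : ℕ) => w (n + 1))^[s] w n = w (s + n) := by
  induction s generalizing w with
  | zero => simp
  | succ s ih => rw [Function.iterate_succ_apply, ih]; congr 1; omega

open ProbabilityTheory in
open Classical in
/-- If the chain is tail-trivial (every shift-invariant measurable event has probability `0`
or `1` under every `P_x`), then for all `x, y` there is a coupling `Q` of `P_x` and `P_y`
under which, almost surely, the two paths coincide eventually up to time-shift. -/
theorem coupling_coincide_up_to_shift_of_tail_trivial
    {V : Type*} [Countable V] [MeasurableSpace V] [DiscreteMeasurableSpace V]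
    (G : SimpleGraph V) [G.LocallyFinite] (hconn : G.Connected)
    (a : V → V → ℝ)
    (hsymm : ∀ x y, a x y = a y x)
    (hpos : ∀ x y, G.Adj x y → 0 < a x y)
    (P : V → Measure (ℕ → V)) (hprob : ∀ x, IsProbabilityMeasure (P x))
    (hP : ∀ (x : V) (n : ℕ) (c : ℕ → V),
      P x {w | ∀ i ≤ n, w i = c i} =
        (if c 0 = x then 1 else 0) *
          ∏ i ∈ Finset.range n, ENNReal.ofReal (step G a (c i) (c (i + 1))))
    (htrans : ∀ x y : V, ∀ᵐ w ∂ P x, {n : ℕ | w n = y}.Finite)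
    (htt : ∀ (x : V) (A : Set (ℕ → V)), MeasurableSet A →
      (fun (w : ℕ → V) (n : ℕ) => w (n + 1)) ⁻¹' A = A → P x A = 0 ∨ P x A = 1)
    (x y : V) :
    ∃ Q : Measure ((ℕ → V) × (ℕ → V)), IsProbabilityMeasure Q ∧
      Q.map Prod.fst = P x ∧ Q.map Prod.snd = P y ∧
      ∀ᵐ q ∂ Q, ∃ S T : ℕ, ∀ n : ℕ, q.1 (S + n) = q.2 (T + n) := by
  have hmarkov := map_shift_restrict_eq_smul (p := fun x y => ENNReal.ofReal (step G a x y))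
    (P := P) hP
  obtain ⟨Q, hQ1, hQ2, hQ⟩ := Measure.exists_shift_coupling
    (θ := fun (w : ℕ → V) (n : ℕ) => w (n + 1)) (by fun_prop) (μ := P x) (ν := P y)
    fun A hA hinv => measure_eq_of_invariant hconn hpos hmarkov hA hinv
      (fun z => htt z A hA hinv) x y
  refine ⟨Q, ⟨?_⟩, hQ1, hQ2, ?_⟩
  · rw [← Set.preimage_univ (f := Prod.fst), ← Measure.map_apply measurable_fst .univ, hQ1,
      measure_univ]
  · filter_upwards [hQ] with q ⟨s, t, hst⟩
    refine ⟨s, t, fun n => ?_⟩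
    rw [← iterate_shift_apply s n q.1, hst, iterate_shift_apply]
end

section
/- Assume the Markov chain X is tail-trivial: for every x ∈ V, every measurable event A ⊆ V^ℕ that is invariant under the shift θ (θ((w_n)_{n≥0}) = (w_{n+1})_{n≥0}, invariance meaning θ^{-1}(A) = A) satisfies P_x(A) ∈ {0,1}. Then for every finite vertex set K ⊆ V and all x, y ∈ ∂_X K, there exists a probability measure Q on V^ℕ × V^ℕ with first marginal P_x[· | τ_K^+ = ∞] and second marginal P_y[· | τ_K^+ = ∞] such that, Q-almost surely for the pair of paths (X, Y), there exist finite (random) times S, T ≥ 0 with X_{S+n} = Y_{T+n} for all n ≥ 0, i.e. the two paths coincide eventually up to time-shift. -/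
open MeasureTheory Filter

section ShiftCoupling

open ProbabilityTheory

variable {Ω E : Type*} [MeasurableSpace Ω] [MeasurableSpace E]

/-- Disintegration of a finite measure `α` along a measurable map `f`. -/
theorem MeasureTheory.Measure.exists_fiber_kernel [StandardBorelSpace Ω] [Nonempty Ω]
    [MeasurableEq E] (α : Measure Ω) [IsFiniteMeasure α] {f : Ω → E} (hf : Measurable f) :
    ∃ κ : Kernel E Ω, IsMarkovKernel κ ∧ κ ∘ₘ α.map f = α ∧
      ∀ᵐ z ∂α.map f, ∀ᵐ w ∂κ z, f w = z := by
  refine ⟨condDistrib id f α, inferInstance, ?_, ?_⟩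
  · rw [condDistrib_comp_map hf.aemeasurable aemeasurable_id, Measure.map_id]
  · have h : ∀ᵐ p ∂(α.map f ⊗ₘ condDistrib id f α), f p.2 = p.1 := by
      rw [compProd_map_condDistrib aemeasurable_id, ae_map_iff (by fun_prop)
        (measurableSet_eq_fun (by fun_prop) (by fun_prop))]
      exact ae_of_all _ fun _ => rfl
    exact Measure.ae_ae_of_ae_compProd h

/-- A common minorant of two finite measures which is the first on `s` and the second on `sᶜ`. -/
theorem exists_common_minorant (a b : Measure E) [IsFiniteMeasure a] [IsFiniteMeasure b] :
    ∃ (ρ : Measure E) (s : Set E), MeasurableSet s ∧ ρ ≤ a ∧ ρ ≤ b ∧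
      ρ s = a s ∧ ρ sᶜ = b sᶜ := by
  obtain ⟨s, hs⟩ := exists_isHahnDecomposition a b
  have hm := hs.measurableSet
  refine ⟨a.restrict s + b.restrict sᶜ, s, hm, ?_, ?_, ?_, ?_⟩
  · calc _ ≤ a.restrict s + a.restrict sᶜ := add_le_add_right hs.ge_on_compl _
      _ = a := Measure.restrict_add_restrict_compl hm
  · calc _ ≤ b.restrict s + b.restrict sᶜ := add_le_add_left hs.le_on _
      _ = b := Measure.restrict_add_restrict_compl hm
  · simp [hm]
  · simp [hm]

/-- A coupling of parts of `α` and `β`, supported on `f = g`, whose leftovers have mutually singular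
images. -/
theorem exists_partial_coupling [StandardBorelSpace Ω] [Nonempty Ω] [MeasurableEq E]
    (α β : Measure Ω) [IsFiniteMeasure α] [IsFiniteMeasure β] {f g : Ω → E}
    (hf : Measurable f) (hg : Measurable g) :
    ∃ (Q : Measure (Ω × Ω)) (α' β' : Measure Ω), Q.map Prod.fst + α' = α ∧
      Q.map Prod.snd + β' = β ∧ (∀ᵐ q ∂Q, f q.1 = g q.2) ∧ α'.map f ⟂ₘ β'.map g := by
  obtain ⟨κ, _, hκ, hκf⟩ := α.exists_fiber_kernel hf
  obtain ⟨η, _, hη, hηg⟩ := β.exists_fiber_kernel hg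
  obtain ⟨ρ, s, hs, hρa, hρb, hρs, hρsc⟩ := exists_common_minorant (α.map f) (β.map g)
  have : IsFiniteMeasure ρ := isFiniteMeasure_of_le _ hρa
  have hlift : ∀ {γ : Measure Ω} [IsFiniteMeasure γ] {h : Ω → E} {θ : Kernel E Ω}
      [IsMarkovKernel θ], Measurable h → θ ∘ₘ γ.map h = γ → (∀ᵐ z ∂γ.map h, ∀ᵐ w ∂θ z, h w = z) →
      ρ ≤ γ.map h → (θ ∘ₘ ρ) + θ ∘ₘ (γ.map h - ρ) = γ ∧
        ∀ t, MeasurableSet t → ρ t = γ.map h t → (θ ∘ₘ (γ.map h - ρ)).map h t = 0 := by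
    intro γ _ h θ _ hh hθ hθh hρ
    have hsum : (θ ∘ₘ ρ) + θ ∘ₘ (γ.map h - ρ) = γ := by
      rw [← Measure.comp_add, add_comm, Measure.sub_add_cancel_of_le hρ, hθ]
    refine ⟨hsum, fun t ht hρt => ?_⟩
    have hle : γ.map h - ρ ≤ γ.map h := Measure.sub_le
    have hae : ∀ᵐ z ∂(γ.map h - ρ), z ∉ t := by
      rw [← measure_eq_zero_iff_ae_notMem, Measure.sub_apply ht hρ, hρt, tsub_self]
    rw [measure_eq_zero_iff_ae_notMem, ae_map_iff hh.aemeasurable ht.compl]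
    refine Measure.ae_comp_of_ae_ae (hh ht.compl) ?_
    filter_upwards [hae, ae_mono hle hθh] with z hz hθz
    filter_upwards [hθz] with w hw
    rwa [hw]
  obtain ⟨hα, hα'⟩ := hlift hf hκ hκf hρa
  obtain ⟨hβ, hβ'⟩ := hlift hg hη hηg hρb
  refine ⟨(κ ×ₖ η) ∘ₘ ρ, _, _, ?_, ?_, ?_, ⟨s, hs, hα' s hs hρs, hβ' sᶜ hs.compl hρsc⟩⟩
  · rw [Measure.map_comp _ _ measurable_fst, ← Kernel.fst_eq, Kernel.fst_prod, hα]
  · rw [Measure.map_comp _ _ measurable_snd, ← Kernel.snd_eq, Kernel.snd_prod, hβ]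
  · refine Measure.ae_comp_of_ae_ae (measurableSet_eq_fun (by fun_prop) (by fun_prop)) ?_
    filter_upwards [ae_mono hρa hκf, ae_mono hρb hηg] with z hz hz'
    rw [Kernel.prod_apply]
    filter_upwards [Measure.quasiMeasurePreserving_fst.ae hz,
      Measure.quasiMeasurePreserving_snd.ae hz'] with q hq hq'
    rw [hq, hq']

/-- Countably many pairs of maps can be exhausted simultaneously by a single partial coupling. -/
theorem exists_exhausting_partial_coupling [StandardBorelSpace Ω] [Nonempty Ω] [MeasurableEq E]
    (α β : Measure Ω) [IsFiniteMeasure α] [IsFiniteMeasure β] {f g : ℕ → Ω → E}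
    (hf : ∀ k, Measurable (f k)) (hg : ∀ k, Measurable (g k)) :
    ∃ (Q : Measure (Ω × Ω)) (α' β' : Measure Ω), Q.map Prod.fst + α' = α ∧
      Q.map Prod.snd + β' = β ∧ (∀ᵐ q ∂Q, ∃ k, f k q.1 = g k q.2) ∧
      ∀ k, α'.map (f k) ⟂ₘ β'.map (g k) := by
  have key : ∀ (k : ℕ) (p : FiniteMeasure Ω × FiniteMeasure Ω),
      ∃ (r : FiniteMeasure Ω × FiniteMeasure Ω) (Q : Measure (Ω × Ω)),
        Q.map Prod.fst + r.1 = (p.1 : Measure Ω) ∧ Q.map Prod.snd + r.2 = (p.2 : Measure Ω) ∧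
        (∀ᵐ q ∂Q, f k q.1 = g k q.2) ∧
        (r.1 : Measure Ω).map (f k) ⟂ₘ (r.2 : Measure Ω).map (g k) := by
    intro k p
    obtain ⟨Q, α', β', h₁, h₂, h₃⟩ :=
      exists_partial_coupling (p.1 : Measure Ω) (p.2 : Measure Ω) (hf k) (hg k)
    have hα' : IsFiniteMeasure α' := isFiniteMeasure_of_le (p.1 : Measure Ω)
      (h₁ ▸ Measure.le_add_left le_rfl)
    have hβ' : IsFiniteMeasure β' := isFiniteMeasure_of_le (p.2 : Measure Ω)
      (h₂ ▸ Measure.le_add_left le_rfl)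
    exact ⟨(⟨α', hα'⟩, ⟨β', hβ'⟩), Q, h₁, h₂, h₃⟩
  choose R Q hfst hsnd hQ hsing using key
  let p : ℕ → FiniteMeasure Ω × FiniteMeasure Ω :=
    Nat.rec (⟨α, inferInstance⟩, ⟨β, inferInstance⟩) R
  have hlim : ∀ {m : ℕ → Measure Ω} {q : ℕ → Measure Ω} (_ : ∀ k, IsFiniteMeasure (m k)),
      (∀ k, q k + m (k + 1) = m k) → ∃ m' : Measure Ω, Measure.sum q + m' = m 0 ∧
        ∀ k, m' ≤ m k := by
    intro m q hm hstep
    have hpart : ∀ k, ∑ j ∈ Finset.range k, q j + m k = m 0 := by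
      intro k
      induction k with
      | zero => simp
      | succ k ih => rw [Finset.sum_range_succ, add_assoc, hstep, ih]
    have hle : Measure.sum q ≤ m 0 := by
      refine Measure.le_iff.2 fun s hs => ?_
      rw [Measure.sum_apply _ hs, ENNReal.tsum_eq_iSup_nat]
      refine iSup_le fun k => ?_
      rw [← hpart k, Measure.add_apply, Measure.finsetSum_apply]
      exact le_self_add
    have := isFiniteMeasure_of_le _ hle
    refine ⟨m 0 - Measure.sum q, by rw [add_comm, Measure.sub_add_cancel_of_le hle], fun k => ?_⟩
    have hk : ∑ j ∈ Finset.range k, q j ≤ Measure.sum q := by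
      refine Measure.le_iff.2 fun s hs => ?_
      rw [Measure.sum_apply _ hs, Measure.finsetSum_apply]
      exact ENNReal.sum_le_tsum _
    refine Measure.sub_le_of_le_add ?_
    rw [← hpart k, add_comm]
    gcongr
  obtain ⟨α', hα', hα'le⟩ := hlim (m := fun k => (p k).1) (q := fun k => (Q k (p k)).map Prod.fst)
    (fun k => inferInstance) (fun k => hfst k (p k))
  obtain ⟨β', hβ', hβ'le⟩ := hlim (m := fun k => (p k).2) (q := fun k => (Q k (p k)).map Prod.snd)
    (fun k => inferInstance) (fun k => hsnd k (p k))
  refine ⟨Measure.sum fun k => Q k (p k), α', β', ?_, ?_, ?_, fun k => ?_⟩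
  · rw [Measure.map_sum measurable_fst.aemeasurable]
    exact hα'
  · rw [Measure.map_sum measurable_snd.aemeasurable]
    exact hβ'
  · refine Measure.ae_sum_iff.2 fun k => ?_
    filter_upwards [hQ k (p k)] with q hq using ⟨k, hq⟩
  · exact (hsing k (p k)).mono (Measure.map_mono (hα'le (k + 1)) (hf k))
      (Measure.map_mono (hβ'le (k + 1)) (hg k))

/-- Two probability measures which agree on the invariant sets of a measurable map `T` admit
a coupling under which the two `T`-orbits almost surely merge up to a time shift. -/
theorem exists_shift_coupling [StandardBorelSpace Ω] [Nonempty Ω]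
    (μ ν : Measure Ω) [IsProbabilityMeasure μ] [IsProbabilityMeasure ν] {T : Ω → Ω}
    (hT : Measurable T) (h : ∀ A, MeasurableSet A → T ⁻¹' A = A → μ A = ν A) :
    ∃ Q : Measure (Ω × Ω), IsProbabilityMeasure Q ∧ Q.map Prod.fst = μ ∧ Q.map Prod.snd = ν ∧
      ∀ᵐ q ∂Q, ∃ m n : ℕ, T^[m] q.1 = T^[n] q.2 := by
  obtain ⟨Q, α', β', hα, hβ, hQ, hsing⟩ := exists_exhausting_partial_coupling μ ν
    (f := fun k => T^[k.unpair.1]) (g := fun k => T^[k.unpair.2])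
    (fun k => hT.iterate _) (fun k => hT.iterate _)
  have hQ' : ∀ᵐ q ∂Q, ∃ m n : ℕ, T^[m] q.1 = T^[n] q.2 := by
    filter_upwards [hQ] with q ⟨k, hk⟩ using ⟨_, _, hk⟩
  have hinv : ∀ A, MeasurableSet A → T ⁻¹' A = A → α' A = β' A := by
    intro A hA hTA
    have hiter : ∀ n w, T^[n] w ∈ A ↔ w ∈ A := by
      intro n
      induction n with
      | zero => simp
      | succ n ih => intro w; rw [Function.iterate_succ_apply, ih, ← Set.mem_preimage, hTA]
    have hm : Q.map Prod.fst A = Q.map Prod.snd A := by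
      rw [Measure.map_apply measurable_fst hA, Measure.map_apply measurable_snd hA]
      refine measure_congr ?_
      filter_upwards [hQ'] with q ⟨m, n, hq⟩
      refine propext ?_
      change q.1 ∈ A ↔ q.2 ∈ A
      rw [← hiter m, hq, hiter n]
    have hle : Q.map Prod.fst A ≤ μ A := by rw [← hα]; exact le_self_add
    have hμν := h A hA hTA
    refine (ENNReal.add_right_inj (ne_top_of_le_ne_top (measure_ne_top μ A) hle)).1 ?_
    conv_rhs => rw [hm]
    rw [← Measure.add_apply, ← Measure.add_apply, hα, hβ, hμν]
  have hzero : ∀ A, MeasurableSet A → T ⁻¹' A = A → α' A = 0 → β' Aᶜ = 0 → α' = 0 ∧ β' = 0 := by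
    intro A hA hTA hαA hβA
    have hβA' : β' A = 0 := hinv A hA hTA ▸ hαA
    have hαA' : α' Aᶜ = 0 := by
      rw [hinv Aᶜ hA.compl (by rw [Set.preimage_compl, hTA]), hβA]
    constructor
    · rw [← Measure.measure_univ_eq_zero, ← Set.union_compl_self A]
      exact measure_union_null hαA hαA'
    · rw [← Measure.measure_univ_eq_zero, ← Set.union_compl_self A]
      exact measure_union_null hβA' hβA
  have hsum : (Measure.sum fun m => α'.map T^[m]) ⟂ₘ Measure.sum fun n => β'.map T^[n] := by
    rw [Measure.MutuallySingular.sum_left]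
    intro m
    rw [Measure.MutuallySingular.sum_right]
    intro n
    simpa using hsing (Nat.pair m n)
  obtain ⟨B, hB, hBα, hBβ⟩ := hsum
  rw [measure_eq_zero_iff_ae_notMem, Measure.ae_sum_iff] at hBα hBβ
  have hBα' : ∀ᵐ w ∂α', ∀ m, T^[m] w ∉ B := ae_all_iff.2 fun m =>
    ae_of_ae_map (hT.iterate m).aemeasurable (hBα m)
  have hBβ' : ∀ᵐ w ∂β', ∀ n, T^[n] w ∈ B := ae_all_iff.2 fun n => by
    filter_upwards [ae_of_ae_map (hT.iterate n).aemeasurable (hBβ n)] with w hw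
    simpa using hw
  obtain ⟨rfl, rfl⟩ : α' = 0 ∧ β' = 0 := by
    refine hzero {w | ∃ N, ∀ n ≥ N, T^[n] w ∈ B} ?_ ?_ ?_ ?_
    · have : {w | ∃ N, ∀ n ≥ N, T^[n] w ∈ B} = ⋃ N, ⋂ n ≥ N, T^[n] ⁻¹' B := by
        ext w; simp
      rw [this]
      exact .iUnion fun N => .iInter fun n => .iInter fun _ => hT.iterate n hB
    · ext w
      simp only [Set.mem_preimage, Set.mem_ofPred_eq, ← Function.iterate_succ_apply]
      constructor
      · rintro ⟨N, hN⟩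
        refine ⟨N + 1, fun n hn => ?_⟩
        obtain ⟨n, rfl⟩ := Nat.exists_eq_add_of_le' (Nat.one_le_of_lt hn)
        exact hN n (by omega)
      · rintro ⟨N, hN⟩
        exact ⟨N, fun n hn => hN (n + 1) (by omega)⟩
    · rw [measure_eq_zero_iff_ae_notMem]
      filter_upwards [hBα'] with w hw ⟨N, hN⟩ using hw N (hN N le_rfl)
    · rw [measure_eq_zero_iff_ae_notMem]
      filter_upwards [hBβ'] with w hw using fun hc => hc ⟨0, fun n _ => hw n⟩
  rw [add_zero] at hα hβ
  refine ⟨Q, ⟨?_⟩, hα, hβ, hQ'⟩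
  rw [← Set.preimage_univ (f := Prod.fst), ← Measure.map_apply measurable_fst .univ, hα,
    measure_univ]

end ShiftCoupling

theorem aTot_pos {V : Type*} {G : SimpleGraph V} [G.LocallyFinite] {a : V → V → ℝ}
    (hpos : ∀ x y, G.Adj x y → 0 < a x y) {x z : V} (hxz : G.Adj x z) : 0 < aTot G a x :=
  Finset.sum_pos (fun y hy => hpos x y (by simpa using hy)) ⟨z, by simpa using hxz⟩

section PathSpace

variable {V : Type*} [Countable V] [MeasurableSpace V] [DiscreteMeasurableSpace V]

theorem measure_ext_of_cylinder {μ ν : Measure (ℕ → V)} [IsFiniteMeasure μ]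
    (h : ∀ (n : ℕ) (c : ℕ → V), μ {w | ∀ i ≤ n, w i = c i} = ν {w | ∀ i ≤ n, w i = c i})
    (huniv : μ Set.univ = ν Set.univ) : μ = ν := by
  refine ext_of_generate_finite
    {s | ∃ (n : ℕ) (c : ℕ → V), s = {w | ∀ i ≤ n, w i = c i}} ?_ ?_ ?_ huniv
  · refine le_antisymm ?_ (MeasurableSpace.generateFrom_le ?_)
    · refine iSup_le fun i => ?_
      rintro _ ⟨s, -, rfl⟩
      rcases isEmpty_or_nonempty V with hV | ⟨⟨v⟩⟩
      · rw [Set.eq_empty_of_isEmpty (_ ⁻¹' s)]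
        exact @MeasurableSet.empty _ (_)
      have hs : (fun w : ℕ → V => w i) ⁻¹' s =
          ⋃ (c : Finset.Iic i → V) (_ : c ⟨i, by simp⟩ ∈ s),
            {w | ∀ j ≤ i, w j = (fun j => if hj : j ≤ i then c ⟨j, by simpa⟩ else v) j} := by
        ext w
        simp only [Set.mem_preimage, Set.mem_iUnion, Set.mem_ofPred_eq]
        constructor
        · intro hw
          exact ⟨fun j => w j, hw, fun j hj => by simp [hj]⟩
        · rintro ⟨c, hc, hw⟩
          rw [hw i le_rfl]
          simpa using hc
      rw [hs]
      refine @MeasurableSet.iUnion _ _ (_) _ _ fun c => @MeasurableSet.iUnion _ _ (_) _ _ fun _ =>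
        MeasurableSpace.measurableSet_generateFrom ⟨i, _, rfl⟩
    · rintro _ ⟨n, c, rfl⟩
      have : {w : ℕ → V | ∀ i ≤ n, w i = c i} = ⋂ i, ⋂ (_ : i ≤ n), (fun w => w i) ⁻¹' {c i} := by
        ext w; simp
      rw [this]
      exact .iInter fun i => .iInter fun _ => measurable_pi_apply i (.singleton _)
  · rintro _ ⟨n, c, rfl⟩ _ ⟨m, d, rfl⟩ ⟨u, hu, hu'⟩
    refine ⟨max n m, u, Set.ext fun w => ⟨fun ⟨hw, hw'⟩ i hi => ?_, fun hw => ⟨?_, ?_⟩⟩⟩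
    · rcases le_max_iff.1 hi with hi | hi
      · rw [hw i hi, hu i hi]
      · rw [hw' i hi, hu' i hi]
    · exact fun i hi => (hw i (hi.trans (le_max_left _ _))).trans (hu i hi)
    · exact fun i hi => (hw i (hi.trans (le_max_right _ _))).trans (hu' i hi)
  · rintro _ ⟨n, c, rfl⟩
    exact h n c

/-- The Markov property at time one, restricted to the event that the first step leads to `z`. -/
theorem map_shift_restrict_first_step {p : V → V → ENNReal}
    {P : V → Measure (ℕ → V)} [∀ x, IsProbabilityMeasure (P x)]
    (hP : ∀ (x : V) (n : ℕ) (c : ℕ → V), P x {w | ∀ i ≤ n, w i = c i} =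
      (open Classical in if c 0 = x then 1 else 0) * ∏ i ∈ Finset.range n, p (c i) (c (i + 1)))
    (x z : V) :
    ((P x).restrict {w | w 1 = z}).map (fun (w : ℕ → V) (n : ℕ) => w (n + 1)) = p x z • P z := by
  classical
  have hθ : Measurable fun (w : ℕ → V) (n : ℕ) => w (n + 1) := by fun_prop
  have hstart : ∀ᵐ w ∂P x, w 0 = x := by
    refine (mem_ae_iff_prob_eq_one
      (measurableSet_eq_fun (by fun_prop) (by fun_prop))).2 ?_
    simpa using hP x 0 fun _ => x
  have hcyl : ∀ (n : ℕ) (c : ℕ → V), P x {w | ∀ i ≤ n, w (i + 1) = c i} =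
      p x (c 0) * ∏ i ∈ Finset.range n, p (c i) (c (i + 1)) := by
    intro n c
    have h := hP x (n + 1) fun i => Nat.casesOn i x c
    rw [Finset.prod_range_succ', mul_comm (∏ _ ∈ _, _)] at h
    rw [if_pos (by rfl), one_mul] at h
    refine Eq.trans ?_ h
    refine measure_congr ?_
    filter_upwards [hstart] with w hw
    refine propext ⟨fun hw' i hi => ?_, fun hw' i hi => hw' (i + 1) (by omega)⟩
    cases i with
    | zero => exact hw
    | succ i => exact hw' i (by omega)
  refine measure_ext_of_cylinder (fun n c => ?_) ?_
  · have hm : MeasurableSet {w : ℕ → V | ∀ i ≤ n, w i = c i} := by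
      measurability
    rw [Measure.map_apply hθ hm, Measure.restrict_apply (hθ hm), Measure.smul_apply, hP z n c,
      smul_eq_mul]
    split_ifs with hc
    · rw [one_mul, ← hc, ← hcyl n c]
      congr 1
      ext w
      exact ⟨fun hw => hw.1, fun hw => ⟨hw, hw 0 (Nat.zero_le n)⟩⟩
    · rw [zero_mul, mul_zero]
      convert measure_empty (μ := P x)
      refine Set.eq_empty_of_forall_notMem fun w ⟨hw, hw'⟩ => hc ?_
      rw [← hw 0 (Nat.zero_le n)]
      exact hw'
  · rw [Measure.map_apply hθ .univ]
    simpa using hcyl 0 fun _ => z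

/-- Almost sure avoidance of an invariant event propagates along possible transitions. -/
theorem measure_eq_zero_of_shift_invariant {p : V → V → ENNReal}
    {P : V → Measure (ℕ → V)} [∀ x, IsProbabilityMeasure (P x)]
    (hP : ∀ (x : V) (n : ℕ) (c : ℕ → V), P x {w | ∀ i ≤ n, w i = c i} =
      (open Classical in if c 0 = x then 1 else 0) * ∏ i ∈ Finset.range n, p (c i) (c (i + 1)))
    {A : Set (ℕ → V)} (hA : MeasurableSet A)
    (hinv : (fun (w : ℕ → V) (n : ℕ) => w (n + 1)) ⁻¹' A = A) {x z : V} (hp : p x z ≠ 0)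
    (h : P x A = 0) : P z A = 0 := by
  have hmap := congrArg (· A) (map_shift_restrict_first_step hP x z)
  have hle : (P x).restrict {w | w 1 = z} A = 0 := Measure.restrict_le_self.absolutelyContinuous h
  simp only [Measure.map_apply (show Measurable fun (w : ℕ → V) (n : ℕ) => w (n + 1) by fun_prop) hA,
    hinv, hle, Measure.smul_apply, smul_eq_mul] at hmap
  exact (mul_eq_zero.1 hmap.symm).resolve_left hp

end PathSpace

open ProbabilityTheory in
open Classical in
/-- If the chain is tail-trivial, then for every finite vertex set `K` and all
`x, y ∈ ∂_X K`, there is a coupling `Q` of `P_x[· | τ_K^+ = ∞]` and `P_y[· | τ_K^+ = ∞]`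
under which, almost surely, the two paths coincide eventually up to time-shift. -/
theorem coupling_conditioned_coincide_up_to_shift_of_tail_trivial
    {V : Type*} [Countable V] [MeasurableSpace V] [DiscreteMeasurableSpace V]
    (G : SimpleGraph V) [G.LocallyFinite] (hconn : G.Connected)
    (a : V → V → ℝ)
    (hsymm : ∀ x y, a x y = a y x)
    (hpos : ∀ x y, G.Adj x y → 0 < a x y)
    (P : V → Measure (ℕ → V)) (hprob : ∀ x, IsProbabilityMeasure (P x))
    (hP : ∀ (x : V) (n : ℕ) (c : ℕ → V),
      P x {w | ∀ i ≤ n, w i = c i} =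
        (if c 0 = x then 1 else 0) *
          ∏ i ∈ Finset.range n, ENNReal.ofReal (step G a (c i) (c (i + 1))))
    (htrans : ∀ x y : V, ∀ᵐ w ∂ P x, {n : ℕ | w n = y}.Finite)
    (htt : ∀ (x : V) (A : Set (ℕ → V)), MeasurableSet A →
      (fun (w : ℕ → V) (n : ℕ) => w (n + 1)) ⁻¹' A = A → P x A = 0 ∨ P x A = 1)
    (K : Finset V) (x y : V)
    (hxK : x ∈ K) (hx : (P x) (noReturn (K : Set V)) ≠ 0)
    (hyK : y ∈ K) (hy : (P y) (noReturn (K : Set V)) ≠ 0) :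
    ∃ Q : Measure ((ℕ → V) × (ℕ → V)), IsProbabilityMeasure Q ∧
      Q.map Prod.fst = (P x)[|noReturn (K : Set V)] ∧
      Q.map Prod.snd = (P y)[|noReturn (K : Set V)] ∧
      ∀ᵐ q ∂ Q, ∃ S T : ℕ, ∀ n : ℕ, q.1 (S + n) = q.2 (T + n) := by
  have : Nonempty V := ⟨x⟩
  have hmono : ∀ A, MeasurableSet A → (fun (w : ℕ → V) (n : ℕ) => w (n + 1)) ⁻¹' A = A →
      ∀ u v, P u A = 0 → P v A = 0 := by
    intro A hA hinv u v hu
    have huv := (SimpleGraph.reachable_iff_reflTransGen u v).1 (hconn.preconnected u v)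
    induction huv with
    | refl => exact hu
    | tail _ hadj ih =>
      refine measure_eq_zero_of_shift_invariant (p := fun x y => ENNReal.ofReal (step G a x y))
        hP hA hinv ?_ ih
      simp only [step, if_pos hadj, ne_eq, ENNReal.ofReal_eq_zero, not_le]
      exact div_pos (hpos _ _ hadj) (aTot_pos hpos hadj)
  have hθ : Measurable fun (w : ℕ → V) (n : ℕ) => w (n + 1) := by fun_prop
  have hμ := cond_isProbabilityMeasure (μ := P x) hx
  have hν := cond_isProbabilityMeasure (μ := P y) hy
  obtain ⟨Q, hQ, hfst, hsnd, hae⟩ := exists_shift_coupling ((P x)[|noReturn (K : Set V)])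
    ((P y)[|noReturn (K : Set V)]) hθ fun A hA hinv => by
      have hinv' : (fun (w : ℕ → V) (n : ℕ) => w (n + 1)) ⁻¹' Aᶜ = Aᶜ := by
        rw [Set.preimage_compl, hinv]
      rcases htt x A hA hinv with h | h
      · rw [cond_absolutelyContinuous h, cond_absolutelyContinuous (hmono A hA hinv x y h)]
      · have h' := (prob_compl_eq_zero_iff hA).2 h
        rw [(prob_compl_eq_zero_iff hA).1 (cond_absolutelyContinuous h'),
          (prob_compl_eq_zero_iff hA).1
            (cond_absolutelyContinuous (hmono Aᶜ hA.compl hinv' x y h'))]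
  refine ⟨Q, hQ, hfst, hsnd, ?_⟩
  have hiter : ∀ (m n : ℕ) (w : ℕ → V), (fun (w : ℕ → V) (n : ℕ) => w (n + 1))^[m] w n =
      w (m + n) := by
    intro m
    induction m with
    | zero => simp
    | succ m ih =>
      intro n w
      rw [Function.iterate_succ_apply, ih]
      congr 1
      omega
  filter_upwards [hae] with q ⟨m, n, hq⟩
  refine ⟨m, n, fun k => ?_⟩
  simpa only [hiter] using congrFun hq k
end
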